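/- For all real numbers x₁, x₂ and every ε > 0, |1{x₁ ≥ 0} − 1{x₂ ≥ 0}| ≤ (|x₁ − x₂|/ε) · 1{|x₁| ≥ ε or |x₂| ≥ ε} + 1{|x₁| < ε and |x₂| < ε}. (This deterministic indicator inequality is the key pointwise step in the paper's proof that the Probit response y = 1[y* ≥ 0] is near-epoch dependent whenever the latent variable y* is.) -/

import Mathlib

/-- For all reals `x₁, x₂` and every `ε > 0`,
`|1{x₁ ≥ 0} − 1{x₂ ≥ 0}| ≤ (|x₁ − x₂|/ε)·1{|x₁| ≥ ε or |x₂| ≥ ε} + 1{|x₁| < ε and |x₂| < ε}`. -/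
theorem stmt12 (x₁ x₂ ε : ℝ) (hε : 0 < ε) :
    |(if 0 ≤ x₁ then (1 : ℝ) else 0) - (if 0 ≤ x₂ then (1 : ℝ) else 0)| ≤
      (|x₁ - x₂| / ε) * (if ε ≤ |x₁| ∨ ε ≤ |x₂| then (1 : ℝ) else 0) +
      (if |x₁| < ε ∧ |x₂| < ε then (1 : ℝ) else 0) := by
  by_cases h : ε ≤ |x₁| ∨ ε ≤ |x₂|
  · have h' : ¬ (|x₁| < ε ∧ |x₂| < ε) := by
      rintro ⟨a, b⟩
      rcases h with h | h <;> linarith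
    rw [if_pos h, if_neg h', mul_one, add_zero]
    have hnn : 0 ≤ |x₁ - x₂| / ε := by positivity
    by_cases h1 : 0 ≤ x₁ <;> by_cases h2 : 0 ≤ x₂
    · simpa [h1, h2] using hnn
    · rw [if_pos h1, if_neg h2, le_div_iff₀ hε]
      push Not at h2
      rw [abs_of_nonneg h1, abs_of_neg h2] at h
      have := le_abs_self (x₁ - x₂)
      norm_num
      rcases h with h | h <;> linarith
    · rw [if_neg h1, if_pos h2, le_div_iff₀ hε]
      push Not at h1
      rw [abs_of_neg h1, abs_of_nonneg h2] at h
      have := neg_le_abs (x₁ - x₂)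
      norm_num
      rcases h with h | h <;> linarith
    · simpa [h1, h2] using hnn
  · have h' : |x₁| < ε ∧ |x₂| < ε := by
      push Not at h
      exact h
    rw [if_neg h, if_pos h']
    split_ifs <;> norm_num
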